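/- arXiv:2405.10978 — 14 statements merged into one kernel-verified Lean document; each statement's English description precedes it below -/
import Mathlib

section
/- Let n, b, c be integers with n ≥ 1 and b ≥ c ≥ 1. Then ∑_{k=0}^{n} (-1)^k · C(n,k) / C(b+k, c) = (c/(n+c)) · 1 / C(n+b, b-c), where C(·,·) denotes the binomial coefficient and the sums and quotients are taken in ℚ (equivalently ℝ). -/
/-- Pascal's rule for alternating binomial sums. -/
lemma alternating_sum_choose_succ {R : Type*} [CommRing R] (f : ℕ → R) (n : ℕ) :
    ∑ k ∈ Finset.range (n + 2), (-1) ^ k * ((n + 1).choose k : R) * f k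
      = ∑ k ∈ Finset.range (n + 1), (-1) ^ k * (n.choose k : R) * f k
        - ∑ k ∈ Finset.range (n + 1), (-1) ^ k * (n.choose k : R) * f (k + 1) := by
  rw [sub_eq_add_neg, ← Finset.sum_neg_distrib]
  refine Eq.trans ?_ ((Finset.sum_choose_succ_mul (fun i _ => (-1) ^ i * f i) n).trans
    (congrArg₂ _ ?_ ?_)) <;>
  exact Finset.sum_congr rfl fun _ _ => by ring

/-- The right-hand side of Frisch's identity satisfies the same recurrence as the left-hand side. -/
lemma frisch_closed_form_succ (n c d : ℕ) (hc : 1 ≤ c) :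
    (c : ℚ) / (n + c) * (1 / ((n + c + d).choose d : ℚ))
        - c / (n + c) * (1 / ((n + c + d + 1).choose (d + 1) : ℚ))
      = c / (n + 1 + c) * (1 / ((n + c + d + 1).choose d : ℚ)) := by
  have h₁ := Nat.choose_mul_succ_eq (n + c + d) d
  have h₂ := Nat.add_one_mul_choose_eq (n + c + d) d
  rw [show n + c + d + 1 - d = n + c + 1 by omega] at h₁
  have hA : ((n + c + d).choose d : ℚ) ≠ 0 := by
    exact_mod_cast (Nat.choose_pos (by omega)).ne'
  have hnc : (n : ℚ) + c ≠ 0 := by exact_mod_cast (by omega : n + c ≠ 0)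
  have hnc' : (n : ℚ) + 1 + c ≠ 0 := by positivity
  have hN : (n : ℚ) + c + d + 1 ≠ 0 := by positivity
  have e₁ : ((n + c + d + 1).choose d : ℚ)
      = (n + c + d).choose d * (n + c + d + 1) / (n + 1 + c) := by
    rw [eq_div_iff hnc']
    have : (((n + c + d).choose d * (n + c + d + 1) : ℕ) : ℚ) = _ := congrArg _ h₁
    push_cast at this
    linear_combination -this
  have e₂ : ((n + c + d + 1).choose (d + 1) : ℚ)
      = (n + c + d).choose d * (n + c + d + 1) / (d + 1) := by
    rw [eq_div_iff (by positivity)]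
    have : (((n + c + d + 1) * (n + c + d).choose d : ℕ) : ℚ) = _ := congrArg _ h₂
    push_cast at this
    linear_combination -this
  rw [e₁, e₂]
  field_simp
  ring

/-- Frisch's identity, including the case `n = 0`, with `b = c + d`. -/
lemma frisch_identity_add (n c d : ℕ) (hc : 1 ≤ c) :
    ∑ k ∈ Finset.range (n + 1),
        (-1 : ℚ) ^ k * (n.choose k : ℚ) * ((c + d + k).choose c : ℚ)⁻¹
      = (c : ℚ) / (n + c) * (1 / ((n + c + d).choose d : ℚ)) := by
  induction n generalizing d with
  | zero =>
    have : (c : ℚ) ≠ 0 := by positivity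
    simp [this, Nat.choose_symm_add (a := c) (b := d)]
  | succ n ih =>
    have h : ∑ k ∈ Finset.range (n + 1),
        (-1 : ℚ) ^ k * (n.choose k : ℚ) * ((c + d + (k + 1)).choose c : ℚ)⁻¹
          = (c : ℚ) / (n + c) * (1 / ((n + c + d + 1).choose (d + 1) : ℚ)) := by
      simpa only [add_assoc, add_comm 1] using ih (d + 1)
    rw [alternating_sum_choose_succ fun k => ((c + d + k).choose c : ℚ)⁻¹, ih d, h,
      frisch_closed_form_succ n c d hc, show n + 1 + c + d = n + c + d + 1 by omega,
      Nat.cast_add_one]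

/-- Frisch's identity for integer parameters: for `n ≥ 1` and `b ≥ c ≥ 1`,
`∑_{k=0}^{n} (-1)^k C(n,k)/C(b+k,c) = (c/(n+c)) · 1/C(n+b, b-c)` in `ℚ`. -/
theorem frisch_identity (n b c : ℕ) (hn : 1 ≤ n) (hc : 1 ≤ c) (hbc : c ≤ b) :
    ∑ k ∈ Finset.range (n + 1),
        (-1 : ℚ) ^ k * (n.choose k : ℚ) / ((b + k).choose c : ℚ)
      = (c : ℚ) / ((n : ℚ) + c) * (1 / (((n + b).choose (b - c) : ℕ) : ℚ)) := by
  obtain ⟨d, rfl⟩ := Nat.exists_eq_add_of_le hbc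
  simpa only [div_eq_mul_inv, Nat.add_sub_cancel_left, add_assoc]
    using frisch_identity_add n c d hc
end

section
/- Let n and b be integers with n ≥ 1 and b ≥ 1. Then ∑_{k=0}^{n} (-1)^k · (C(n,k)/C(b+k,k)) · (H_{k+b} − H_k) = (b/(n+b)) · H_{n+b}, where all quotients are taken in ℚ (equivalently ℝ). -/
/- `harmonic m = ∑_{j=1}^m 1/j` is Mathlib's harmonic number `harmonic : ℕ → ℚ`. -/

/-- An alternating binomial sum of order `n + 1` is one of order `n` of the differences. -/
lemma sum_neg_one_pow_mul_choose_succ {R : Type*} [CommRing R] (F : ℕ → R) (n : ℕ) :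
    ∑ k ∈ Finset.range (n + 2), (-1 : R) ^ k * ((n + 1).choose k : R) * F k
      = ∑ k ∈ Finset.range (n + 1), (-1 : R) ^ k * (n.choose k : R) * (F k - F (k + 1)) := by
  have h : ∑ k ∈ Finset.range (n + 1), (-1 : R) ^ k * (n.choose k : R) * F k
      = ∑ k ∈ Finset.range (n + 1), (-1 : R) ^ (k + 1) * (n.choose (k + 1) : R) * F (k + 1)
        + F 0 := by
    have h₁ := Finset.sum_range_succ (fun k ↦ (-1 : R) ^ k * (n.choose k : R) * F k) (n + 1)
    rw [Finset.sum_range_succ'] at h₁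
    simpa using h₁.symm
  simp only [mul_sub, Finset.sum_sub_distrib]
  rw [h, Finset.sum_range_succ', add_sub_right_comm, ← Finset.sum_sub_distrib]
  congr 1
  · refine Finset.sum_congr rfl fun k _ ↦ ?_
    rw [Nat.choose_succ_succ]
    push_cast
    ring
  · simp

lemma harmonic_div_choose_sub_succ (b k : ℕ) :
    (harmonic (k + b) - harmonic k) / ((b + k).choose k : ℚ)
        - (harmonic (k + 1 + b) - harmonic (k + 1)) / ((b + (k + 1)).choose (k + 1) : ℚ)
      = (b : ℚ) / (b + 1) *
        ((harmonic (k + (b + 1)) - harmonic k) / ((b + 1 + k).choose k : ℚ)) := by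
  have hc : ((b + k).choose k : ℚ) ≠ 0 :=
    Nat.cast_ne_zero.mpr (Nat.choose_pos (Nat.le_add_left k b)).ne'
  have h₁ : ((b + (k + 1)).choose (k + 1) : ℚ) = (b + k + 1) / (k + 1) * (b + k).choose k := by
    have := Nat.add_one_mul_choose_eq (b + k) k
    rw [← add_assoc]
    field_simp
    exact_mod_cast this.symm
  have h₂ : ((b + 1 + k).choose k : ℚ) = (b + k + 1) / (b + 1) * (b + k).choose k := by
    have := Nat.add_one_mul_choose_eq (b + k) b
    rw [Nat.choose_symm_add, show b + k + 1 = b + 1 + k by ring, Nat.choose_symm_add] at this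
    field_simp
    have h : ((b + 1 + k : ℕ) : ℚ) * (b + k).choose k = (b + 1 + k).choose k * (b + 1 : ℕ) :=
      mod_cast this
    push_cast at h
    linear_combination -h
  rw [h₁, h₂, show k + 1 + b = k + b + 1 by ring, ← add_assoc k b 1, harmonic_succ (k + b),
    harmonic_succ k]
  push_cast
  have : (b : ℚ) + k + 1 ≠ 0 := by positivity
  have : (k : ℚ) + b + 1 ≠ 0 := by positivity
  have : (k : ℚ) + 1 ≠ 0 := by positivity
  have : (b : ℚ) + 1 ≠ 0 := by positivity
  field_simp
  ring

lemma sum_choose_mul_harmonic_div_choose (n b : ℕ) (hb : 1 ≤ b) :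
    ∑ k ∈ Finset.range (n + 1), (-1 : ℚ) ^ k * (n.choose k : ℚ) *
        ((harmonic (k + b) - harmonic k) / ((b + k).choose k : ℚ))
      = (b : ℚ) / ((n : ℚ) + b) * harmonic (n + b) := by
  induction n generalizing b with
  | zero =>
    have : (b : ℚ) ≠ 0 := Nat.cast_ne_zero.mpr (by omega)
    simp [this]
  | succ n ih =>
    rw [sum_neg_one_pow_mul_choose_succ
      (fun k ↦ (harmonic (k + b) - harmonic k) / ((b + k).choose k : ℚ))]
    simp only [harmonic_div_choose_sub_succ, mul_left_comm _ ((b : ℚ) / (b + 1))]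
    rw [← Finset.mul_sum, ih (b + 1) (by omega), show n + (b + 1) = n + 1 + b by ring]
    push_cast
    have : (b : ℚ) + 1 ≠ 0 := by positivity
    have : (n : ℚ) + 1 + b ≠ 0 := by positivity
    have : (n : ℚ) + (b + 1) ≠ 0 := by positivity
    field_simp
    ring

theorem frisch_harmonic_special (n b : ℕ) (hn : 1 ≤ n) (hb : 1 ≤ b) :
    ∑ k ∈ Finset.range (n + 1),
        (-1 : ℚ) ^ k * ((n.choose k : ℚ) / ((b + k).choose k : ℚ)) *
          (harmonic (k + b) - harmonic k)
      = (b : ℚ) / ((n : ℚ) + b) * harmonic (n + b) := by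
  rw [← sum_choose_mul_harmonic_div_choose n b hb]
  exact Finset.sum_congr rfl fun k _ ↦ by ring
end

section
/- Let n, b, c be integers with n ≥ 1 and b ≥ c ≥ 1. Then ∑_{k=0}^{n} (-1)^{k+1} · (C(n,k)/C(b+k,c)) · (H_{k+b−c} − H_c) = (1/((n+c)·C(n+b, n+c))) · ( n/(n+c) + c·(H_{n+c} − H_{b−c}) ), where all quotients are taken in ℚ (equivalently ℝ). -/
/-- Pascal's rule for alternating binomial sums. -/
theorem sum_alternating_choose_succ (f : ℕ → ℚ) (n : ℕ) :
    ∑ k ∈ Finset.range (n + 2), (-1 : ℚ) ^ (k + 1) * ((n + 1).choose k : ℚ) * f k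
      = ∑ k ∈ Finset.range (n + 1), (-1 : ℚ) ^ (k + 1) * (n.choose k : ℚ) * f k
        - ∑ k ∈ Finset.range (n + 1), (-1 : ℚ) ^ (k + 1) * (n.choose k : ℚ) * f (k + 1) := by
  have h : ∑ k ∈ Finset.range (n + 1), (-1 : ℚ) ^ (k + 1) * (n.choose k : ℚ) * f k
      = ∑ k ∈ Finset.range (n + 2), (-1 : ℚ) ^ (k + 1) * (n.choose k : ℚ) * f k := by
    rw [Finset.sum_range_succ _ (n + 1)]
    simp
  rw [h, Finset.sum_range_succ' _ (n + 1), Finset.sum_range_succ' _ (n + 1),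
    add_sub_right_comm, ← Finset.sum_sub_distrib]
  congr 1
  · refine Finset.sum_congr rfl fun k _ => ?_
    rw [Nat.choose_succ_succ]
    push_cast
    ring
  · simp

/-- The identity `frisch_harmonic_c` with `b = m + c`, valid for `n = 0` as well. -/
theorem sum_alternating_choose_div_choose_mul_harmonic (n m c : ℕ) (hc : 1 ≤ c) :
    ∑ k ∈ Finset.range (n + 1), (-1 : ℚ) ^ (k + 1) * (n.choose k : ℚ) *
        ((harmonic (m + k) - harmonic c) / ((m + k + c).choose c : ℚ))
      = 1 / (((n : ℚ) + c) * ((n + c + m).choose (n + c) : ℚ)) *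
          ((n : ℚ) / ((n : ℚ) + c) + (c : ℚ) * (harmonic (n + c) - harmonic m)) := by
  have hc0 : (0 : ℚ) < c := by exact_mod_cast hc
  induction n generalizing m with
  | zero =>
    have h : ((c + m).choose c : ℚ) ≠ 0 := by
      exact_mod_cast (Nat.choose_pos (Nat.le_add_right c m)).ne'
    simp only [zero_add, Finset.sum_range_one, Nat.choose_self, add_zero, add_comm m c]
    field_simp
    simp
    ring
  | succ n ih =>
    have ih' := ih (m + 1)
    simp only [add_right_comm m 1, add_assoc m _ 1] at ih'
    rw [sum_alternating_choose_succ
      (fun k => (harmonic (m + k) - harmonic c) / ((m + k + c).choose c : ℚ)), ih m]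
    simp only [ih']
    have hC : ((n + c + m).choose (n + c) : ℚ) ≠ 0 := by
      exact_mod_cast (Nat.choose_pos (Nat.le_add_right _ m)).ne'
    have h1 : ((n + c + (m + 1)).choose (n + c) : ℚ)
        = (n + c + m).choose (n + c) * (n + c + m + 1) / (m + 1) := by
      have h := Nat.choose_mul_succ_eq (n + c + m) (n + c)
      rw [show n + c + m + 1 - (n + c) = m + 1 by omega] at h
      rw [eq_div_iff (by positivity)]
      exact_mod_cast h.symm
    have h2 : ((n + 1 + c + m).choose (n + 1 + c) : ℚ)
        = (n + c + m).choose (n + c) * (n + c + m + 1) / (n + c + 1) := by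
      have h := Nat.add_one_mul_choose_eq (n + c + m) (n + c)
      rw [show n + 1 + c + m = n + c + m + 1 by omega, show n + 1 + c = n + c + 1 by omega,
        eq_div_iff (by positivity), mul_comm ((n + c + m).choose (n + c) : ℚ)]
      exact_mod_cast h.symm
    rw [h1, h2, show n + 1 + c = n + c + 1 by omega, harmonic_succ, harmonic_succ]
    have hN : (n : ℚ) + c ≠ 0 := by positivity
    have hN2 : (n : ℚ) + c + 1 ≠ 0 := by positivity
    have hm : (m : ℚ) + 1 ≠ 0 := by positivity
    have hNm : (n : ℚ) + c + m + 1 ≠ 0 := by positivity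
    push_cast
    rw [add_right_comm (n : ℚ) 1 c]
    field_simp
    ring

theorem frisch_harmonic_c (n b c : ℕ) (hn : 1 ≤ n) (hc : 1 ≤ c) (hbc : c ≤ b) :
    ∑ k ∈ Finset.range (n + 1),
        (-1 : ℚ) ^ (k + 1) * ((n.choose k : ℚ) / ((b + k).choose c : ℚ)) *
          (harmonic (k + b - c) - harmonic c)
      = 1 / (((n : ℚ) + c) * ((n + b).choose (n + c) : ℚ)) *
          ((n : ℚ) / ((n : ℚ) + c) + (c : ℚ) * (harmonic (n + c) - harmonic (b - c))) := by
  obtain ⟨m, rfl⟩ := Nat.exists_eq_add_of_le hbc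
  rw [Nat.add_sub_cancel_left, ← add_assoc n c m,
    ← sum_alternating_choose_div_choose_mul_harmonic n m c hc]
  refine Finset.sum_congr rfl fun k _ => ?_
  rw [show k + (c + m) - c = m + k by omega, show c + m + k = m + k + c by omega]
  ring
end

section
/- Let n and b be integers with n ≥ 1 and b ≥ 0. Then ∑_{k=0}^{n} (-1)^{k+1} · C(n,k) · H_{k+b} = 1 / (n · C(n+b, n)), where all quotients are taken in ℚ (equivalently ℝ). -/
/-- The iterated forward differences of the harmonic numbers. -/
theorem fwdDiff_iter_succ_harmonic (n b : ℕ) :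
    (fwdDiff 1)^[n + 1] harmonic b
      = (-1) ^ n / (((n + 1 : ℕ) : ℚ) * ((n + 1 + b).choose (n + 1) : ℚ)) := by
  induction n generalizing b with
  | zero => simp [fwdDiff, harmonic_succ, add_comm]
  | succ n ih =>
    rw [Function.iterate_succ_apply', fwdDiff, ih, ih]
    have hC : ((n + 1 + b).choose (n + 1) : ℚ) ≠ 0 :=
      Nat.cast_ne_zero.2 (Nat.choose_pos (by omega)).ne'
    have h₁ : ((n + 1 + (b + 1)).choose (n + 1) : ℚ)
        = (n + 1 + b).choose (n + 1) * (n + b + 2) / (b + 1) := by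
      rw [eq_div_iff (by positivity)]
      have h := Nat.choose_mul_succ_eq (n + 1 + b) (n + 1)
      rw [show n + 1 + b + 1 - (n + 1) = b + 1 by omega] at h
      have h' := congrArg (Nat.cast : ℕ → ℚ) h
      push_cast at h'
      rw [← add_assoc, ← h']
      ring
    have h₂ : ((n + 1 + 1 + b).choose (n + 1 + 1) : ℚ)
        = (n + 1 + b).choose (n + 1) * (n + b + 2) / (n + 2) := by
      rw [eq_div_iff (by positivity), show n + 1 + 1 + b = n + 1 + b + 1 by omega]
      have h' := congrArg (Nat.cast : ℕ → ℚ) (Nat.add_one_mul_choose_eq (n + 1 + b) (n + 1))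
      push_cast at h'
      linear_combination -h'
    rw [h₁, h₂]
    push_cast
    field_simp
    ring

theorem binomial_transform_harmonic_shifted (n b : ℕ) (hn : 1 ≤ n) :
    ∑ k ∈ Finset.range (n + 1),
        (-1 : ℚ) ^ (k + 1) * (n.choose k : ℚ) * harmonic (k + b)
      = 1 / ((n : ℚ) * ((n + b).choose n : ℚ)) := by
  obtain ⟨m, rfl⟩ := Nat.exists_eq_add_of_le' hn
  have hsq : ((-1 : ℚ) ^ m) * (-1) ^ m = 1 := by rw [← mul_pow]; simp
  calc
    _ = (-1) ^ m * (fwdDiff 1)^[m + 1] harmonic b := by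
      rw [fwdDiff_iter_eq_sum_shift, Finset.mul_sum]
      refine Finset.sum_congr rfl fun k hk ↦ ?_
      obtain ⟨j, hj⟩ := Nat.exists_eq_add_of_le (Nat.lt_succ_iff.1 (Finset.mem_range.1 hk))
      have hsign : (-1 : ℚ) ^ (k + 1) = (-1) ^ m * (-1) ^ (m + 1 - k) := by
        rw [show m + 1 - k = j by omega]
        have hjj : ((-1 : ℚ) ^ j) * (-1) ^ j = 1 := by rw [← mul_pow]; simp
        have hm : (-1 : ℚ) ^ (m + 1) = (-1) ^ k * (-1) ^ j := by rw [hj, pow_add]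
        rw [pow_succ] at hm ⊢
        linear_combination (-1) ^ j * hm + (-1) ^ k * hjj
      rw [hsign, zsmul_eq_mul, smul_eq_mul, mul_one, add_comm b k]
      push_cast
      ring
    _ = _ := by
      rw [fwdDiff_iter_succ_harmonic, ← mul_div_assoc, hsq]
end

section
/- Let n and b be integers with n ≥ 0 and b ≥ 0. Then ∑_{k=1}^{n} (-1)^{k+1} · C(n,k) / (k · C(k+b, k)) = H_{n+b} − H_b, where all quotients are taken in ℚ (equivalently ℝ). -/
/- `harmonic m = ∑_{j=1}^m 1/j` is Mathlib's harmonic number `harmonic : ℕ → ℚ`. -/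

theorem cast_choose_succ_mul (n m : ℕ) :
    (n.choose (m + 1) : ℚ) * (m + 1) = n.choose m * (n - m) := by
  rcases le_or_gt m n with h | h
  · have := Nat.choose_succ_right_eq n m
    rw [← Nat.cast_sub h]
    exact_mod_cast this
  · simp [Nat.choose_eq_zero_of_lt h, Nat.choose_eq_zero_of_lt (h.trans (Nat.lt_succ_self m))]

theorem cast_choose_add_pos (m c : ℕ) : (0 : ℚ) < (m + c).choose m := by
  exact_mod_cast Nat.choose_pos (Nat.le_add_right m c)

theorem alternating_choose_ratio_step (n c m : ℕ) :
    ((m + 1 : ℕ) + c : ℚ) * ((-1) ^ (m + 1) * n.choose (m + 1) / (m + 1 + c).choose (m + 1))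
      = (m - n : ℚ) * ((-1) ^ m * n.choose m / (m + c).choose m) := by
  have h₁ := cast_choose_succ_mul n m
  have h₂ : ((m + c : ℚ) + 1) * (m + c).choose m = (m + 1 + c).choose (m + 1) * (m + 1) := by
    rw [Nat.add_right_comm m 1 c]
    exact_mod_cast Nat.add_one_mul_choose_eq (m + c) m
  have p₁ := (cast_choose_add_pos m c).ne'
  have p₂ := (cast_choose_add_pos (m + 1) c).ne'
  have p₃ : (m + 1 : ℚ) ≠ 0 := by positivity
  rw [← mul_div_assoc, ← mul_div_assoc, div_eq_div_iff p₂ p₁]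
  apply mul_right_cancel₀ p₃
  push_cast
  rw [pow_succ]
  linear_combination (-(-1) ^ m * (m + 1 + c) * ((m + c).choose m : ℚ)) * h₁
    - (-1) ^ m * n.choose m * (n - m) * h₂

theorem sum_range_alternating_choose_ratio (n c m : ℕ) :
    (n + c : ℚ) * ∑ j ∈ Finset.range m, (-1 : ℚ) ^ j * n.choose j / (j + c).choose j
      = c - (m + c) * ((-1) ^ m * n.choose m / (m + c).choose m) := by
  induction m with
  | zero => simp
  | succ m ih =>
    rw [Finset.sum_range_succ, mul_add, ih, alternating_choose_ratio_step]
    ring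

theorem succ_mul_cast_choose (b j : ℕ) :
    ((j + 1 : ℕ) : ℚ) * (j + 1 + b).choose (j + 1) = (b + 1) * (j + (b + 1)).choose j := by
  have h := Nat.choose_succ_right_eq (j + 1 + b) j
  rw [show j + 1 + b - j = b + 1 by omega] at h
  rw [show j + (b + 1) = j + 1 + b by omega, mul_comm, mul_comm (b + 1 : ℚ)]
  exact_mod_cast h

theorem sum_alternating_choose_div (n b : ℕ) :
    ∑ j ∈ Finset.range (n + 1),
        (-1 : ℚ) ^ (j + 1 + 1) * n.choose j / ((j + 1 : ℕ) * (j + 1 + b).choose (j + 1))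
      = ((n + b + 1 : ℕ) : ℚ)⁻¹ := by
  have h := sum_range_alternating_choose_ratio n (b + 1) (n + 1)
  simp only [Nat.choose_succ_self, Nat.cast_zero, mul_zero, zero_div, sub_zero] at h
  have hb : (b + 1 : ℚ) ≠ 0 := by positivity
  have key : ∀ j ∈ Finset.range (n + 1),
      (-1 : ℚ) ^ (j + 1 + 1) * n.choose j / ((j + 1 : ℕ) * (j + 1 + b).choose (j + 1))
        = (b + 1 : ℚ)⁻¹ * ((-1 : ℚ) ^ j * n.choose j / (j + (b + 1)).choose j) := by
    intro j _
    rw [succ_mul_cast_choose, pow_succ, pow_succ]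
    have := (cast_choose_add_pos j (b + 1)).ne'
    field_simp
  rw [Finset.sum_congr rfl key, ← Finset.mul_sum]
  push_cast at h ⊢
  apply eq_inv_of_mul_eq_one_left
  apply mul_left_cancel₀ hb
  rw [mul_assoc, mul_inv_cancel_left₀ hb]
  linear_combination h

theorem harmonic_difference_identity (n b : ℕ) :
    ∑ k ∈ Finset.Icc 1 n,
        (-1 : ℚ) ^ (k + 1) * (n.choose k : ℚ) / ((k : ℚ) * ((k + b).choose k : ℚ))
      = harmonic (n + b) - harmonic b := by
  have reindex : ∀ (f : ℕ → ℚ) (m : ℕ),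
      ∑ k ∈ Finset.Icc 1 m, f k = ∑ j ∈ Finset.range m, f (j + 1) := by
    intro f m
    rw [Finset.range_eq_Ico, Finset.sum_Ico_add' f 0 m 1]
    rfl
  rw [reindex]
  induction n with
  | zero => simp
  | succ n ih =>
    rw [Nat.add_right_comm n 1 b, harmonic_succ, ← sum_alternating_choose_div, add_sub_right_comm,
      ← ih]
    have h : ∑ j ∈ Finset.range n, (-1 : ℚ) ^ (j + 1 + 1) * (n.choose (j + 1) : ℚ) /
          (((j + 1 : ℕ) : ℚ) * ((j + 1 + b).choose (j + 1) : ℚ))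
        = ∑ j ∈ Finset.range (n + 1), (-1 : ℚ) ^ (j + 1 + 1) * (n.choose (j + 1) : ℚ) /
          (((j + 1 : ℕ) : ℚ) * ((j + 1 + b).choose (j + 1) : ℚ)) := by
      simp [Finset.sum_range_succ]
    rw [h, ← Finset.sum_add_distrib]
    refine Finset.sum_congr rfl fun j _ => ?_
    rw [Nat.choose_succ_succ, Nat.cast_add]
    ring
end

section
/- Let n and b be integers with n ≥ 1 and b ≥ 1. Then ∑_{k=0}^{n} (-1)^k · (C(n,k)/C(k+b, k)) · H_{k+b} = (b/(n+b)) · H_b − n/(n+b)^2, where all quotients are taken in ℚ (equivalently ℝ). -/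
/-- An alternating binomial sum of order `n + 1` is one of order `n` of the differences. -/
theorem sum_neg_one_pow_choose_succ (n : ℕ) (f : ℕ → ℚ) :
    ∑ k ∈ Finset.range (n + 2), (-1 : ℚ) ^ k * ((n + 1).choose k : ℚ) * f k
      = ∑ k ∈ Finset.range (n + 1), (-1 : ℚ) ^ k * (n.choose k : ℚ) * (f k - f (k + 1)) := by
  have h : ∑ k ∈ Finset.range (n + 1), (-1 : ℚ) ^ k * (n.choose k : ℚ) * f k
      = ∑ k ∈ Finset.range (n + 1), (-1 : ℚ) ^ (k + 1) * (n.choose (k + 1) : ℚ) * f (k + 1)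
        + f 0 := by
    have h₁ := Finset.sum_range_succ (fun k => (-1 : ℚ) ^ k * (n.choose k : ℚ) * f k) (n + 1)
    rw [Finset.sum_range_succ'] at h₁
    simpa using h₁.symm
  rw [Finset.sum_range_succ']
  simp only [mul_sub, Finset.sum_sub_distrib]
  rw [h, add_sub_right_comm, ← Finset.sum_sub_distrib]
  congr 1
  · refine Finset.sum_congr rfl fun k _ => ?_
    rw [Nat.choose_succ_succ]
    push_cast
    ring
  · simp

theorem inv_choose_add_succ_left (k b : ℕ) :
    ((k + 1 + b).choose (k + 1) : ℚ)⁻¹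
      = (k + 1) / (k + b + 1) * ((k + b).choose k : ℚ)⁻¹ := by
  have h : ((k + b + 1 : ℕ) : ℚ) * ((k + b).choose k : ℚ)
      = ((k + b + 1).choose (k + 1) : ℚ) * ((k + 1 : ℕ) : ℚ) := by
    exact_mod_cast Nat.add_one_mul_choose_eq (k + b) k
  have h₁ : ((k + b).choose k : ℚ) ≠ 0 := by
    exact_mod_cast (Nat.choose_pos (Nat.le_add_right k b)).ne'
  have h₂ : ((k + b + 1).choose (k + 1) : ℚ) ≠ 0 := by
    exact_mod_cast (Nat.choose_pos (by omega)).ne'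
  have h₃ : (k : ℚ) + b + 1 ≠ 0 := by positivity
  rw [show k + 1 + b = k + b + 1 by ring]
  push_cast at h
  field_simp
  linear_combination h

theorem inv_choose_add_succ_right (k b : ℕ) :
    ((k + (b + 1)).choose k : ℚ)⁻¹
      = (b + 1) / (k + b + 1) * ((k + b).choose k : ℚ)⁻¹ := by
  have h := inv_choose_add_succ_left b k
  rw [Nat.choose_symm_add, add_comm k (b + 1), h, Nat.choose_symm_add, add_comm b k]
  ring

theorem sum_neg_one_pow_choose_mul_inv_choose (n b : ℕ) (hb : 1 ≤ b) :
    ∑ k ∈ Finset.range (n + 1),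
        (-1 : ℚ) ^ k * (n.choose k : ℚ) * ((k + b).choose k : ℚ)⁻¹ = b / (n + b) := by
  induction n generalizing b with
  | zero =>
    have : (b : ℚ) ≠ 0 := by positivity
    simp [this]
  | succ n ih =>
    rw [sum_neg_one_pow_choose_succ n fun k => ((k + b).choose k : ℚ)⁻¹]
    have h (k : ℕ) : ((k + b).choose k : ℚ)⁻¹ - ((k + 1 + b).choose (k + 1) : ℚ)⁻¹
        = b / (b + 1) * ((k + (b + 1)).choose k : ℚ)⁻¹ := by
      rw [inv_choose_add_succ_left, inv_choose_add_succ_right]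
      field_simp
      ring
    simp only [h, mul_left_comm _ ((b : ℚ) / (b + 1))]
    rw [← Finset.mul_sum, ih (b + 1) (by omega)]
    push_cast
    field_simp
    ring

theorem sum_neg_one_pow_choose_mul_inv_choose_mul_harmonic (n b : ℕ) (hb : 1 ≤ b) :
    ∑ k ∈ Finset.range (n + 1),
        (-1 : ℚ) ^ k * (n.choose k : ℚ) * (((k + b).choose k : ℚ)⁻¹ * harmonic (k + b))
      = (b : ℚ) / (n + b) * harmonic b - n / ((n : ℚ) + b) ^ 2 := by
  induction n generalizing b with
  | zero =>
    have : (b : ℚ) ≠ 0 := by positivity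
    simp [this]
  | succ n ih =>
    rw [sum_neg_one_pow_choose_succ n fun k => ((k + b).choose k : ℚ)⁻¹ * harmonic (k + b)]
    have h (k : ℕ) : ((k + b).choose k : ℚ)⁻¹ * harmonic (k + b)
          - ((k + 1 + b).choose (k + 1) : ℚ)⁻¹ * harmonic (k + 1 + b)
        = b / (b + 1) * (((k + (b + 1)).choose k : ℚ)⁻¹ * harmonic (k + (b + 1)))
          - 1 / (b + 1) * ((k + (b + 1)).choose k : ℚ)⁻¹ := by
      rw [inv_choose_add_succ_left, inv_choose_add_succ_right,
        show k + 1 + b = k + b + 1 by ring, ← add_assoc k b 1, harmonic_succ]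
      push_cast
      field_simp
      ring
    simp only [h, mul_sub, Finset.sum_sub_distrib, mul_left_comm _ ((b : ℚ) / (b + 1)),
      mul_left_comm _ ((1 : ℚ) / (b + 1))]
    rw [← Finset.mul_sum, ← Finset.mul_sum, ih (b + 1) (by omega),
      sum_neg_one_pow_choose_mul_inv_choose n (b + 1) (by omega), harmonic_succ]
    push_cast
    field_simp
    ring

theorem frisch_corollary_harmonic (n b : ℕ) (hn : 1 ≤ n) (hb : 1 ≤ b) :
    ∑ k ∈ Finset.range (n + 1),
        (-1 : ℚ) ^ k * ((n.choose k : ℚ) / ((k + b).choose k : ℚ)) * harmonic (k + b)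
      = (b : ℚ) / ((n : ℚ) + b) * harmonic b - (n : ℚ) / ((n : ℚ) + b) ^ 2 := by
  rw [← sum_neg_one_pow_choose_mul_inv_choose_mul_harmonic n b hb]
  refine Finset.sum_congr rfl fun k _ => ?_
  ring
end

section
/- Let n and b be integers with n ≥ 1 and b ≥ 1. Then ∑_{k=0}^{n} (-1)^{k-1} · (C(n,k)/C(b+k, k)) · H_k = (b/(n+b)) · (H_{n+b} − H_b) + n/(n+b)^2, where all quotients are taken in ℚ (equivalently ℝ). -/
theorem sum_range_neg_one_pow_mul_choose_succ_succ (M K : ℕ) :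
    ∑ k ∈ Finset.range K, (-1 : ℚ) ^ k * ((M + 1).choose (k + 1) : ℚ)
      = 1 - (-1) ^ K * (M.choose K : ℚ) := by
  induction K with
  | zero => simp
  | succ K ih =>
    rw [Finset.sum_range_succ, ih, Nat.choose_succ_succ, pow_succ]
    push_cast
    ring

theorem sum_range_neg_one_pow_mul_choose_div_succ (M K : ℕ) (h : M < K) :
    ∑ k ∈ Finset.range K, (-1 : ℚ) ^ k * (M.choose k : ℚ) / ((k : ℚ) + 1)
      = 1 / ((M : ℚ) + 1) := by
  have key := sum_range_neg_one_pow_mul_choose_succ_succ M K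
  rw [Nat.choose_eq_zero_of_lt h] at key
  simp only [Nat.cast_zero, mul_zero, sub_zero] at key
  rw [show 1 / ((M : ℚ) + 1) = _ from congrArg (· / ((M : ℚ) + 1)) key.symm, Finset.sum_div]
  refine Finset.sum_congr rfl fun k _ => ?_
  have e : ((M : ℚ) + 1) * M.choose k = (M + 1).choose (k + 1) * ((k : ℚ) + 1) := by
    exact_mod_cast Nat.add_one_mul_choose_eq M k
  rw [div_eq_div_iff (by positivity) (by positivity)]
  linear_combination (-1 : ℚ) ^ k * e

theorem sum_range_neg_one_pow_mul_choose_add_div_succ (M c K : ℕ) (h : M ≤ K + c) :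
    ∑ k ∈ Finset.range K, (-1 : ℚ) ^ k * (M.choose (c + 1 + k) : ℚ) / ((k : ℚ) + 1)
      = (M.choose c : ℚ) * (harmonic M - harmonic c) := by
  induction M generalizing c with
  | zero =>
    have hz : ∀ k, Nat.choose 0 (c + 1 + k) = 0 := fun k =>
      Nat.choose_eq_zero_of_lt (by omega)
    simp only [hz]
    cases c <;> simp
  | succ M ih =>
    have split : ∀ k, (M + 1).choose (c + 1 + k) = M.choose (c + k) + M.choose (c + 1 + k) := by
      intro k
      rw [show c + 1 + k = (c + k) + 1 by ring, Nat.choose_succ_succ]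
    simp only [split, Nat.cast_add, mul_add, add_div, Finset.sum_add_distrib]
    rw [ih c (by omega)]
    cases c with
    | zero =>
      simp only [zero_add]
      rw [sum_range_neg_one_pow_mul_choose_div_succ M K (by omega), harmonic_succ]
      simp
      ring
    | succ c =>
      rw [ih c (by omega), harmonic_succ, harmonic_succ, Nat.choose_succ_succ]
      have e : ((M : ℚ) + 1) * M.choose c
          = (M.choose c + M.choose (c + 1)) * ((c : ℚ) + 1) := by
        have := Nat.add_one_mul_choose_eq M c
        rw [Nat.choose_succ_succ] at this
        exact_mod_cast this
      push_cast
      have h1 : (M : ℚ) + 1 ≠ 0 := by positivity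
      have h2 : (c : ℚ) + 1 ≠ 0 := by positivity
      field_simp
      linear_combination e

theorem sum_range_neg_one_pow_mul_choose_mul_harmonic (N c K : ℕ) :
    ∑ k ∈ Finset.range (K + 1),
        (-1 : ℚ) ^ (k + 1) * ((N + 1).choose (c + 1 + k) : ℚ) * harmonic k
      = ∑ k ∈ Finset.range K, (-1 : ℚ) ^ k * (N.choose (c + 1 + k) : ℚ) / ((k : ℚ) + 1)
        - (-1) ^ K * (N.choose (c + 1 + K) : ℚ) * harmonic K := by
  induction K with
  | zero => simp
  | succ K ih =>
    rw [Finset.sum_range_succ, ih, Finset.sum_range_succ,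
      show c + 1 + (K + 1) = (c + 1 + K) + 1 by ring, Nat.choose_succ_succ, harmonic_succ]
    push_cast
    ring

theorem choose_div_choose_add (n b k : ℕ) :
    (n.choose k : ℚ) / ((b + k).choose k : ℚ)
      = ((n + b).choose (b + k) : ℚ) / ((n + b).choose b : ℚ) := by
  have h1 : ((b + k).choose k : ℚ) ≠ 0 :=
    Nat.cast_ne_zero.mpr (Nat.choose_pos (by omega)).ne'
  have h2 : ((n + b).choose b : ℚ) ≠ 0 :=
    Nat.cast_ne_zero.mpr (Nat.choose_pos (by omega)).ne'
  rw [div_eq_div_iff h1 h2]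
  rcases le_or_gt k n with hk | hk
  · have e := Nat.choose_mul (n := n + b) (k := b + k) (s := b) (by omega)
    rw [Nat.add_sub_cancel, Nat.add_sub_cancel_left, Nat.choose_symm_add] at e
    rw [mul_comm]
    exact_mod_cast e.symm
  · rw [Nat.choose_eq_zero_of_lt hk, Nat.choose_eq_zero_of_lt (by omega : n + b < b + k)]
    simp

theorem frisch_harmonic_Hk (n b : ℕ) (hn : 1 ≤ n) (hb : 1 ≤ b) :
    ∑ k ∈ Finset.range (n + 1),
        (-1 : ℚ) ^ (k + 1) * ((n.choose k : ℚ) / ((b + k).choose k : ℚ)) * harmonic k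
      = (b : ℚ) / ((n : ℚ) + b) * (harmonic (n + b) - harmonic b)
          + (n : ℚ) / ((n : ℚ) + b) ^ 2 := by
  obtain ⟨c, rfl⟩ : ∃ c, b = c + 1 := ⟨b - 1, by omega⟩
  have hC : ((n + (c + 1)).choose (c + 1) : ℚ) ≠ 0 :=
    Nat.cast_ne_zero.mpr (Nat.choose_pos (by omega)).ne'
  have hsum : ∑ k ∈ Finset.range (n + 1),
        (-1 : ℚ) ^ (k + 1) * ((n.choose k : ℚ) / ((c + 1 + k).choose k : ℚ)) * harmonic k
      = (((n + c).choose c : ℚ) * (harmonic (n + c) - harmonic c))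
        / ((n + (c + 1)).choose (c + 1) : ℚ) := by
    have e := sum_range_neg_one_pow_mul_choose_mul_harmonic (n + c) c n
    rw [Nat.choose_eq_zero_of_lt (by omega : n + c < c + 1 + n),
      sum_range_neg_one_pow_mul_choose_add_div_succ (n + c) c n le_rfl] at e
    simp only [Nat.cast_zero, mul_zero, zero_mul, sub_zero] at e
    rw [← e, Finset.sum_div]
    refine Finset.sum_congr rfl fun k _ => ?_
    rw [choose_div_choose_add, ← add_assoc n c 1]
    ring
  have e : ((n : ℚ) + c + 1) * (n + c).choose c
      = (n + (c + 1)).choose (c + 1) * ((c : ℚ) + 1) := by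
    exact_mod_cast Nat.add_one_mul_choose_eq (n + c) c
  have h1 : (n : ℚ) + c + 1 ≠ 0 := by positivity
  have h2 : (c : ℚ) + 1 ≠ 0 := by positivity
  have hq : ((n + c).choose c : ℚ)
      = (n + (c + 1)).choose (c + 1) * (((c : ℚ) + 1) / ((n : ℚ) + c + 1)) := by
    field_simp
    linear_combination e
  rw [hsum, hq, mul_assoc, mul_div_cancel_left₀ _ hC, ← add_assoc n c 1, harmonic_succ,
    harmonic_succ]
  push_cast
  rw [← add_assoc (n : ℚ) c 1]
  field_simp
  ring
end

section
/- Let n and b be integers with n ≥ 1 and b ≥ 0. Then ∑_{k=0}^{n} (-1)^{k-1} · C(n,k) · H^{(2)}_{k+b} = (H_{n+b} − H_b) / (n · C(n+b, n)), where all quotients are taken in ℚ (equivalently ℝ). -/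
/- `harmonic m = ∑_{j=1}^m 1/j` is Mathlib's harmonic number `harmonic : ℕ → ℚ`. -/

/-- The second-order harmonic number `H^{(2)} m = ∑_{j=1}^m 1/j^2`. -/
def harmonic2 (m : ℕ) : ℚ := ∑ j ∈ Finset.range m, (1 : ℚ) / ((j : ℚ) + 1) ^ 2

/-- The iterated forward differences of `harmonic2` in closed form. -/
lemma fwdDiff_iter_succ_harmonic2 (n b : ℕ) :
    (fwdDiff 1)^[n + 1] harmonic2 b = (-1 : ℚ) ^ n *
      ((harmonic (n + 1 + b) - harmonic b) /
        (((n + 1 : ℕ) : ℚ) * ((n + 1 + b).choose (n + 1) : ℚ))) := by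
  induction n generalizing b with
  | zero =>
    have hb : (b : ℚ) + 1 ≠ 0 := by positivity
    simp only [zero_add, Function.iterate_one, fwdDiff, harmonic2, Finset.sum_range_succ,
      Nat.add_comm 1 b, harmonic_succ, Nat.choose_one_right]
    push_cast
    field_simp
    ring
  | succ n ih =>
    rw [Function.iterate_succ_apply', fwdDiff, ih, ih]
    have hc : ((n + 1 + b).choose (n + 1) : ℚ) ≠ 0 := by
      exact_mod_cast (Nat.choose_pos (Nat.le_add_right _ _)).ne'
    have hb : (b : ℚ) + 1 ≠ 0 := by positivity
    have hn : (n : ℚ) + 1 ≠ 0 := by positivity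
    have hn2 : (n : ℚ) + 1 + 1 ≠ 0 := by positivity
    have hN : (n : ℚ) + 1 + b + 1 ≠ 0 := by positivity
    have h1 : ((n + 1 + b + 1).choose (n + 1) : ℚ) =
        (n + 1 + b + 1) * (n + 1 + b).choose (n + 1) / (b + 1) := by
      rw [eq_div_iff hb]
      have h := Nat.choose_mul_succ_eq (n + 1 + b) (n + 1)
      rw [show n + 1 + b + 1 - (n + 1) = b + 1 by lia] at h
      have h' := congrArg (Nat.cast : ℕ → ℚ) h
      push_cast at h'
      linear_combination -h'
    have h2 : ((n + 1 + b + 1).choose (n + 1 + 1) : ℚ) =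
        (n + 1 + b + 1) * (n + 1 + b).choose (n + 1) / (n + 1 + 1) := by
      rw [eq_div_iff hn2]
      exact_mod_cast (Nat.add_one_mul_choose_eq (n + 1 + b) (n + 1)).symm
    rw [show n + 1 + (b + 1) = n + 1 + b + 1 by ring,
      show n + 1 + 1 + b = n + 1 + b + 1 by ring, h1, h2, harmonic_succ, harmonic_succ]
    push_cast
    field_simp
    ring

theorem binomial_transform_harmonic2 (n b : ℕ) (hn : 1 ≤ n) :
    ∑ k ∈ Finset.range (n + 1),
        (-1 : ℚ) ^ (k + 1) * (n.choose k : ℚ) * harmonic2 (k + b)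
      = (harmonic (n + b) - harmonic b) / ((n : ℚ) * ((n + b).choose n : ℚ)) := by
  obtain ⟨m, rfl⟩ := Nat.exists_eq_add_of_le' hn
  have h := fwdDiff_iter_succ_harmonic2 m b
  rw [fwdDiff_iter_eq_sum_shift] at h
  have hs : (-1 : ℚ) ^ m * (-1 : ℚ) ^ m = 1 := by rw [← mul_pow]; simp
  apply_fun ((-1 : ℚ) ^ m * ·) at h
  rw [← mul_assoc, hs, one_mul] at h
  rw [← h, Finset.mul_sum]
  refine Finset.sum_congr rfl fun k hk => ?_
  obtain ⟨j, hj⟩ := Nat.exists_eq_add_of_le (Nat.lt_succ_iff.mp (Finset.mem_range.mp hk))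
  have hsign : (-1 : ℚ) ^ (k + 1) = (-1) ^ m * (-1) ^ (m + 1 - k) := by
    have hj2 : (-1 : ℚ) ^ j * (-1 : ℚ) ^ j = 1 := by rw [← mul_pow]; simp
    have hm : (-1 : ℚ) ^ (m + 1) = (-1) ^ k * (-1) ^ j := by rw [hj, pow_add]
    rw [show m + 1 - k = j by lia]
    rw [pow_succ] at hm ⊢
    linear_combination (-1 : ℚ) ^ j * hm + (-1 : ℚ) ^ k * hj2
  rw [hsign, zsmul_eq_mul, smul_eq_mul, mul_one, add_comm k b]
  push_cast
  ring
end

section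
/- Let n and b be integers with n ≥ 1 and b ≥ 0. Then ∑_{k=1}^{n} (-1)^{k-1} · C(n,k) · H_{k+b} / (k · C(k+b, k)) = (H_{n+b} − H_b)·H_b + H^{(2)}_{n+b} − H^{(2)}_b, where all quotients are taken in ℚ (equivalently ℝ). -/
/-- Pascal's rule applied termwise to a binomial sum. -/
theorem sum_range_choose_succ_mul (f : ℕ → ℚ) (n : ℕ) :
    ∑ i ∈ Finset.range (n + 2), ((n + 1).choose i : ℚ) * f i
      = ∑ i ∈ Finset.range (n + 1), (n.choose i : ℚ) * f i
        + ∑ i ∈ Finset.range (n + 1), (n.choose i : ℚ) * f (i + 1) :=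
  Finset.sum_choose_succ_mul (fun i _ => f i) n

/-- An array whose rows are successive (backward-signed) differences is given by alternating
binomial sums of its first row. -/
theorem sum_alternating_choose_eq_of_diff (g : ℕ → ℕ → ℚ)
    (hg : ∀ n m, g (n + 1) m = g n m - g n (m + 1)) (n m : ℕ) :
    ∑ j ∈ Finset.range (n + 1), (n.choose j : ℚ) * ((-1) ^ j * g 0 (m + j)) = g n m := by
  induction n generalizing m with
  | zero => simp
  | succ n ih =>
    rw [sum_range_choose_succ_mul (fun j => (-1) ^ j * g 0 (m + j)), hg, ← ih m, ← ih (m + 1),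
      sub_eq_add_neg, ← Finset.sum_neg_distrib]
    congr 1
    refine Finset.sum_congr rfl fun j _ => ?_
    rw [show m + 1 + j = m + (j + 1) by ring]
    ring

/-- Alternating binomial sum of a harmonic number times a beta value. -/
theorem sum_alternating_choose_mul_harmonic_beta (n b : ℕ) :
    ∑ j ∈ Finset.range (n + 1), (n.choose j : ℚ) *
        ((-1) ^ j * ((j.factorial * b.factorial : ℚ) / (j + b + 1).factorial
          * harmonic (j + b + 1)))
      = (harmonic b + 1 / ((n : ℚ) + b + 1)) / ((n : ℚ) + b + 1) := by
  have key := sum_alternating_choose_eq_of_diff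
    (fun n m => (m.factorial * (b + n).factorial : ℚ) / (m + (b + n) + 1).factorial
      * (harmonic (m + (b + n) + 1) - harmonic (b + n) + harmonic b)) (fun n m => ?_) n 0
  · simp only [zero_add, add_zero, sub_add_cancel] at key
    rw [key, Nat.factorial_succ, harmonic_succ]
    have := Nat.factorial_ne_zero (b + n)
    push_cast
    field_simp
    ring
  · rw [show m + (b + (n + 1)) + 1 = (m + (b + n) + 1) + 1 by ring,
      show m + 1 + (b + n) + 1 = (m + (b + n) + 1) + 1 by ring, ← add_assoc b n 1,
      harmonic_succ (m + (b + n) + 1), harmonic_succ (b + n),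
      Nat.factorial_succ (m + (b + n) + 1), Nat.factorial_succ (b + n), Nat.factorial_succ m]
    have := Nat.factorial_ne_zero (m + (b + n) + 1)
    push_cast
    field_simp
    ring

theorem succ_mul_choose_add_succ (j b : ℕ) :
    (((j + 1 : ℕ) : ℚ) * ((j + 1 + b).choose (j + 1) : ℚ))
      = (j + b + 1).factorial / (j.factorial * b.factorial) := by
  rw [Nat.cast_add_choose, Nat.factorial_succ j, show j + 1 + b = j + b + 1 by ring]
  have := Nat.factorial_ne_zero j
  push_cast
  field_simp

theorem harmonic_shifted_over_k_choose (n b : ℕ) (hn : 1 ≤ n) :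
    ∑ k ∈ Finset.Icc 1 n,
        (-1 : ℚ) ^ (k + 1) * (n.choose k : ℚ) * harmonic (k + b)
          / ((k : ℚ) * ((k + b).choose k : ℚ))
      = (harmonic (n + b) - harmonic b) * harmonic b
          + harmonic2 (n + b) - harmonic2 b := by
  clear hn
  let F : ℕ → ℚ := fun k =>
    (-1) ^ (k + 1) * harmonic (k + b) / ((k : ℚ) * ((k + b).choose k : ℚ))
  have hF (j : ℕ) : F (j + 1) = (-1) ^ j * ((j.factorial * b.factorial : ℚ)
      / (j + b + 1).factorial * harmonic (j + b + 1)) := by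
    simp only [F]
    rw [succ_mul_choose_add_succ, show j + 1 + b = j + b + 1 by ring]
    field_simp
    ring
  have hsum (n : ℕ) : ∑ k ∈ Finset.range (n + 1), (n.choose k : ℚ) * F k
      = (harmonic (n + b) - harmonic b) * harmonic b + harmonic2 (n + b) - harmonic2 b := by
    induction n with
    | zero => simp [F]
    | succ n ih =>
      rw [sum_range_choose_succ_mul, ih]
      simp only [hF]
      rw [sum_alternating_choose_mul_harmonic_beta, show n + 1 + b = n + b + 1 by ring,
        harmonic_succ, harmonic2, harmonic2, harmonic2, Finset.sum_range_succ _ (n + b)]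
      push_cast
      field_simp
      ring
  rw [← hsum n, Finset.range_eq_Ico, Finset.sum_eq_sum_Ico_succ_bot (Nat.succ_pos n)]
  simp only [F, Nat.cast_zero, zero_mul, div_zero, mul_zero, zero_add]
  refine Finset.sum_congr rfl fun k _ => ?_
  ring
end

section
/- Let n and b be integers with n ≥ 1 and b ≥ 0. Then ∑_{k=0}^{n} (-1)^{k-1} · (C(n,k)/C(b+k, b)) · H_k · H_{k+b} = (1/(n+b)) · ( b·H_b − n/(n+b) ) · (H_{n+b} − H_b) + (b/(n+b)) · ( H^{(2)}_{n+b} − H^{(2)}_b ) + (n/(n+b)^2) · ( 2/(n+b) + H_b ), where all quotients are taken in ℚ (equivalently ℝ). -/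
theorem harmonic2_succ (m : ℕ) : harmonic2 (m + 1) = harmonic2 m + 1 / ((m : ℚ) + 1) ^ 2 :=
  Finset.sum_range_succ _ m

/-- The alternating sum `∑_{k=0}^n (-1)^k C(n,k) / C(b+k,b) f(k)`. -/
def altChooseSum (b n : ℕ) (f : ℕ → ℚ) : ℚ :=
  ∑ k ∈ Finset.range (n + 1), (-1 : ℚ) ^ k * ((n.choose k : ℚ) / ((b + k).choose b : ℚ)) * f k

theorem altChooseSum_congr {b n : ℕ} {f g : ℕ → ℚ} (h : ∀ k, f k = g k) :
    altChooseSum b n f = altChooseSum b n g := by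
  rw [funext h]

theorem altChooseSum_add (b n : ℕ) (f g : ℕ → ℚ) :
    altChooseSum b n (fun k => f k + g k) = altChooseSum b n f + altChooseSum b n g := by
  simp only [altChooseSum, mul_add, Finset.sum_add_distrib]

theorem altChooseSum_zero (b : ℕ) (f : ℕ → ℚ) : altChooseSum b 0 f = f 0 := by
  simp [altChooseSum]

theorem cast_add_choose_ne_zero (b k : ℕ) : ((b + k).choose b : ℚ) ≠ 0 := by
  exact_mod_cast (Nat.choose_pos (Nat.le_add_right b k)).ne'

theorem choose_div_choose_succ (b n k : ℕ) :
    ((n : ℚ) + 1 + b) * (((n + 1).choose (k + 1) : ℚ) / ((b + (k + 1)).choose b : ℚ)) =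
      ((n : ℚ) + 1) * ((n.choose (k + 1) : ℚ) / ((b + (k + 1)).choose b : ℚ) +
        (n.choose k : ℚ) / ((b + k).choose b : ℚ)) := by
  have h1 : ((b + (k + 1)).choose b : ℚ) * ((k : ℚ) + 1) = ((b + k).choose b : ℚ) * (b + k + 1) := by
    have h := Nat.choose_mul_succ_eq (b + k) b
    rw [show b + k + 1 - b = k + 1 by omega] at h
    exact_mod_cast h.symm
  have h2 : ((n : ℚ) + 1) * (n.choose k : ℚ) = ((n + 1).choose (k + 1) : ℚ) * (k + 1) := by
    exact_mod_cast Nat.add_one_mul_choose_eq n k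
  have h3 : ((n + 1).choose (k + 1) : ℚ) = (n.choose k : ℚ) + (n.choose (k + 1) : ℚ) := by
    exact_mod_cast Nat.choose_succ_succ n k
  have hd := cast_add_choose_ne_zero b k
  have hk : (k : ℚ) + 1 ≠ 0 := by positivity
  have hb : ((b + (k + 1)).choose b : ℚ) = ((b + k).choose b : ℚ) * (b + k + 1) / (k + 1) := by
    rw [eq_div_iff hk, h1]
  have hbk : (b : ℚ) + k + 1 ≠ 0 := by positivity
  have hc : (n.choose (k + 1) : ℚ) = ((n : ℚ) + 1) * (n.choose k : ℚ) / (k + 1) - n.choose k := by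
    rw [h2, h3]; field_simp; ring
  rw [h3, hb, hc]
  field_simp
  ring

/-- Summation by parts for `altChooseSum`. -/
theorem altChooseSum_succ (b n : ℕ) (f : ℕ → ℚ) :
    ((n : ℚ) + 1 + b) * altChooseSum b (n + 1) f =
      b * f 0 - (n + 1) * altChooseSum b n (fun k => f (k + 1) - f k) := by
  have hsplit : altChooseSum b n f = f 0 - ∑ k ∈ Finset.range (n + 1),
      (-1 : ℚ) ^ k * ((n.choose (k + 1) : ℚ) / ((b + (k + 1)).choose b : ℚ)) * f (k + 1) := by
    have h : altChooseSum b n f = ∑ k ∈ Finset.range (n + 1 + 1),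
        (-1 : ℚ) ^ k * ((n.choose k : ℚ) / ((b + k).choose b : ℚ)) * f k := by
      rw [Finset.sum_range_succ, Nat.choose_succ_self]
      simp [altChooseSum]
    rw [h, Finset.sum_range_succ', sub_eq_add_neg, add_comm, ← Finset.sum_neg_distrib]
    congr 1
    · simp
    · exact Finset.sum_congr rfl fun k _ => by ring
  have hsub : altChooseSum b n (fun k => f (k + 1) - f k) =
      altChooseSum b n (fun k => f (k + 1)) - altChooseSum b n f := by
    simp only [altChooseSum, mul_sub, Finset.sum_sub_distrib]
  rw [hsub, hsplit]
  have hmain : ((n : ℚ) + 1 + b) * altChooseSum b (n + 1) f =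
      ((n : ℚ) + 1 + b) * f 0 - (n + 1) * (∑ k ∈ Finset.range (n + 1),
        (-1 : ℚ) ^ k * ((n.choose (k + 1) : ℚ) / ((b + (k + 1)).choose b : ℚ)) * f (k + 1) +
        altChooseSum b n (fun k => f (k + 1))) := by
    unfold altChooseSum
    rw [Finset.sum_range_succ', ← Finset.sum_add_distrib, mul_add, Finset.mul_sum, Finset.mul_sum,
      sub_eq_add_neg, add_comm, ← Finset.sum_neg_distrib]
    congr 1
    · simp
    · refine Finset.sum_congr rfl fun k _ => ?_
      linear_combination (-1 : ℚ) ^ (k + 1) * f (k + 1) * choose_div_choose_succ b n k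
  rw [hmain]
  ring

theorem altChooseSum_div_add (b n : ℕ) (f : ℕ → ℚ) :
    altChooseSum b n (fun k => f k / ((k : ℚ) + b + 1)) = altChooseSum (b + 1) n f / (b + 1) := by
  unfold altChooseSum
  rw [Finset.sum_div]
  refine Finset.sum_congr rfl fun k _ => ?_
  have h : ((b + 1 + k).choose (b + 1) : ℚ) = ((b + k).choose b : ℚ) * (k + b + 1) / (b + 1) := by
    rw [eq_div_iff (by positivity), show b + 1 + k = b + k + 1 by omega]
    have h' := Nat.add_one_mul_choose_eq (b + k) b
    have h'' : ((b : ℚ) + k + 1) * ((b + k).choose b : ℚ) =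
      ((b + k + 1).choose (b + 1) : ℚ) * (b + 1) := by exact_mod_cast h'
    linear_combination -h''
  have hd := cast_add_choose_ne_zero b k
  have hbk : (k : ℚ) + b + 1 ≠ 0 := by positivity
  rw [h]
  field_simp

theorem altChooseSum_div_succ (b n : ℕ) (f : ℕ → ℚ) :
    ((n : ℚ) + 2) * altChooseSum b (n + 1) (fun k => f k / ((k : ℚ) + 1)) =
      (n + 1) * altChooseSum b n (fun k => f k / ((k : ℚ) + 1)) + altChooseSum b (n + 1) f := by
  have h : altChooseSum b n (fun k => f k / ((k : ℚ) + 1)) = ∑ k ∈ Finset.range (n + 1 + 1),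
      (-1 : ℚ) ^ k * ((n.choose k : ℚ) / ((b + k).choose b : ℚ)) * (f k / ((k : ℚ) + 1)) := by
    rw [Finset.sum_range_succ _ (n + 1), Nat.choose_succ_self]
    simp [altChooseSum]
  rw [h]
  unfold altChooseSum
  rw [Finset.mul_sum, Finset.mul_sum, ← Finset.sum_add_distrib]
  refine Finset.sum_congr rfl fun k hk => ?_
  have hkn : k ≤ n + 1 := by simpa [Nat.lt_succ_iff] using hk
  have hc : ((n : ℚ) + 1) * n.choose k = (n + 1).choose k * (n + 1 - k) := by
    have := Nat.choose_mul_succ_eq n k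
    have h' : ((n.choose k * (n + 1) : ℕ) : ℚ) = ((n + 1).choose k * (n + 1 - k) : ℕ) := by
      rw [this]
    push_cast [Nat.cast_sub hkn] at h'
    linear_combination h'
  have hd := cast_add_choose_ne_zero b k
  have hk1 : (k : ℚ) + 1 ≠ 0 := by positivity
  field_simp
  linear_combination -f k * hc

theorem altChooseSum_one (b n : ℕ) :
    ((n : ℚ) + 1 + b) * altChooseSum b (n + 1) (fun _ => 1) = b := by
  rw [altChooseSum_succ]
  simp [altChooseSum]

theorem altChooseSum_one_div_succ (b n : ℕ) :
    ((n : ℚ) + 1) * altChooseSum b n (fun k => 1 / ((k : ℚ) + 1)) =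
      1 + b * (harmonic (n + b) - harmonic b) := by
  induction n with
  | zero => simp [altChooseSum_zero]
  | succ n ih =>
    have h := altChooseSum_div_succ b n (fun _ => 1)
    have h1 := altChooseSum_one b n
    have hN : (n : ℚ) + 1 + b ≠ 0 := by positivity
    rw [mul_comm, ← eq_div_iff hN] at h1
    rw [ih, h1] at h
    rw [show n + 1 + b = n + b + 1 by omega, harmonic_succ]
    push_cast
    rw [show (n : ℚ) + 1 + 1 = n + 2 by ring, h, show (n : ℚ) + b + 1 = n + 1 + b by ring]
    field_simp
    ring

theorem altChooseSum_harmonic (b n : ℕ) :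
    ((n : ℚ) + b + 1) * altChooseSum (b + 1) n harmonic =
      -((n : ℚ) / (n + b + 1) + (b + 1) * (harmonic (n + b + 1) - harmonic (b + 1))) := by
  cases n with
  | zero => simp [altChooseSum_zero]
  | succ n =>
    have h := altChooseSum_succ (b + 1) n harmonic
    have h1 := altChooseSum_one_div_succ (b + 1) n
    have hf : altChooseSum (b + 1) n (fun k => harmonic (k + 1) - harmonic k) =
        altChooseSum (b + 1) n (fun k => 1 / ((k : ℚ) + 1)) :=
      altChooseSum_congr fun k => by rw [harmonic_succ]; push_cast; ring
    rw [hf, h1] at h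
    have hN : (n : ℚ) + 1 + b + 1 ≠ 0 := by positivity
    rw [show n + 1 + b + 1 = n + (b + 1) + 1 by omega, harmonic_succ (n + (b + 1))]
    push_cast at h ⊢
    rw [show (n : ℚ) + (b + 1) + 1 = n + 1 + b + 1 by ring]
    rw [harmonic_zero] at h
    field_simp
    linear_combination ((n : ℚ) + 1 + b + 1) * h

theorem altChooseSum_harmonic_add (b n : ℕ) :
    ((n : ℚ) + 1 + b) * altChooseSum b (n + 1) (fun k => harmonic (k + b)) =
      b * harmonic b - (n + 1) / (n + 1 + b) := by
  have hf : altChooseSum b n (fun k => harmonic (k + 1 + b) - harmonic (k + b)) =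
      altChooseSum b n (fun k => 1 / ((k : ℚ) + b + 1)) :=
    altChooseSum_congr fun k => by
      rw [show k + 1 + b = k + b + 1 by omega, harmonic_succ]; push_cast; ring
  rw [altChooseSum_succ, hf, altChooseSum_div_add b n (fun _ => 1), zero_add]
  have hN : (n : ℚ) + 1 + b ≠ 0 := by positivity
  have hb : (b : ℚ) + 1 ≠ 0 := by positivity
  have h1 : ((n : ℚ) + 1 + b) * altChooseSum (b + 1) n (fun _ => 1) = b + 1 := by
    cases n with
    | zero => simp [altChooseSum_zero, add_comm]
    | succ m =>
      have h := altChooseSum_one (b + 1) m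
      push_cast at h ⊢
      linear_combination h
  rw [mul_comm, ← eq_div_iff hN] at h1
  rw [h1]
  field_simp

theorem altChooseSum_harmonic_add_div_succ (b n : ℕ) :
    ((n : ℚ) + 1) * altChooseSum b n (fun k => harmonic (k + b) / ((k : ℚ) + 1)) =
      harmonic b + (b * harmonic b - 1) * (harmonic (n + b) - harmonic b) +
        b * (harmonic2 (n + b) - harmonic2 b) := by
  induction n with
  | zero => simp [altChooseSum_zero]
  | succ n ih =>
    have h := altChooseSum_div_succ b n (fun k => harmonic (k + b))
    have h1 := altChooseSum_harmonic_add b n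
    have hN : (n : ℚ) + 1 + b ≠ 0 := by positivity
    rw [mul_comm, ← eq_div_iff hN] at h1
    rw [ih, h1] at h
    rw [show n + 1 + b = n + b + 1 by omega, harmonic_succ, harmonic2_succ]
    push_cast
    rw [show (n : ℚ) + 1 + 1 = n + 2 by ring, h, show (n : ℚ) + b + 1 = n + 1 + b by ring]
    field_simp
    ring

theorem altChooseSum_harmonic_mul_diff (b n : ℕ) :
    altChooseSum b n
        (fun k => harmonic (k + 1) * harmonic (k + 1 + b) - harmonic k * harmonic (k + b)) =
      altChooseSum (b + 1) n harmonic / (b + 1) +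
        altChooseSum b n (fun k => harmonic (k + b) / ((k : ℚ) + 1)) +
        altChooseSum (b + 1) n (fun k => 1 / ((k : ℚ) + 1)) / (b + 1) := by
  rw [← altChooseSum_div_add, ← altChooseSum_div_add, ← altChooseSum_add, ← altChooseSum_add]
  refine altChooseSum_congr fun k => ?_
  rw [show k + 1 + b = k + b + 1 by omega, harmonic_succ, harmonic_succ]
  have hbk : (k : ℚ) + b + 1 ≠ 0 := by positivity
  push_cast
  field_simp
  ring

theorem frisch_harmonic_product (n b : ℕ) (hn : 1 ≤ n) :
    ∑ k ∈ Finset.range (n + 1),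
        (-1 : ℚ) ^ (k + 1) * ((n.choose k : ℚ) / ((b + k).choose b : ℚ)) *
          harmonic k * harmonic (k + b)
      = 1 / ((n : ℚ) + b) * ((b : ℚ) * harmonic b - (n : ℚ) / ((n : ℚ) + b)) *
            (harmonic (n + b) - harmonic b)
          + (b : ℚ) / ((n : ℚ) + b) * (harmonic2 (n + b) - harmonic2 b)
          + (n : ℚ) / ((n : ℚ) + b) ^ 2 * (2 / ((n : ℚ) + b) + harmonic b) := by
  obtain ⟨n, rfl⟩ : ∃ m, n = m + 1 := ⟨n - 1, by omega⟩
  have hsum : ∑ k ∈ Finset.range (n + 1 + 1),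
        (-1 : ℚ) ^ (k + 1) * (((n + 1).choose k : ℚ) / ((b + k).choose b : ℚ)) *
          harmonic k * harmonic (k + b) =
      -altChooseSum b (n + 1) (fun k => harmonic k * harmonic (k + b)) := by
    rw [altChooseSum, ← Finset.sum_neg_distrib]
    exact Finset.sum_congr rfl fun k _ => by ring
  have hN : (n : ℚ) + 1 + b ≠ 0 := by positivity
  have hN' : (n : ℚ) + b + 1 ≠ 0 := by positivity
  have hn1 : (n : ℚ) + 1 ≠ 0 := by positivity
  have hb1 : (b : ℚ) + 1 ≠ 0 := by positivity
  have h := altChooseSum_succ b n (fun k => harmonic k * harmonic (k + b))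
  have hA := altChooseSum_harmonic b n
  have hB := altChooseSum_harmonic_add_div_succ b n
  have hC := altChooseSum_one_div_succ (b + 1) n
  rw [altChooseSum_harmonic_mul_diff] at h
  rw [mul_comm, ← eq_div_iff hN'] at hA
  rw [mul_comm, ← eq_div_iff hn1] at hB hC
  rw [hA, hB, hC, mul_comm, ← eq_div_iff hN] at h
  rw [hsum, h, show n + 1 + b = n + b + 1 by omega, show n + (b + 1) = n + b + 1 by omega, harmonic2_succ,
    harmonic_succ, harmonic_succ, harmonic_zero]
  push_cast
  rw [show (n : ℚ) + b + 1 = n + 1 + b by ring]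
  field_simp
  ring
end

section
/- Let n be an integer with n ≥ 1. Then ∑_{k=0}^{n} (-1)^k · C(n,k) · H_k^2 = H_n/n − 2/n^2, where all quotients are taken in ℚ (equivalently ℝ). -/
/-- The (alternating) binomial transform `∑_{k ≤ n} (-1)^k C(n,k) f(k)` of a sequence `f`. -/
def binomialTransform (f : ℕ → ℚ) (n : ℕ) : ℚ :=
  ∑ k ∈ Finset.range (n + 1), (-1 : ℚ) ^ k * (n.choose k : ℚ) * f k

theorem binomialTransform_succ (f : ℕ → ℚ) (n : ℕ) :
    binomialTransform f (n + 1)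
      = binomialTransform f n - binomialTransform (fun k => f (k + 1)) n := by
  have h : binomialTransform f n
      = ∑ k ∈ Finset.range (n + 1 + 1), (-1 : ℚ) ^ k * (n.choose k : ℚ) * f k := by
    rw [Finset.sum_range_succ]
    simp [binomialTransform]
  rw [h, Finset.sum_range_succ', binomialTransform, Finset.sum_range_succ', binomialTransform,
    add_sub_right_comm, ← Finset.sum_sub_distrib]
  congr 1
  · refine Finset.sum_congr rfl fun k _ => ?_
    rw [Nat.choose_succ_succ]
    push_cast
    ring
  · simp

theorem binomialTransform_shift_div (g : ℕ → ℚ) (n : ℕ) :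
    binomialTransform (fun k => g (k + 1) / ((k : ℚ) + 1)) n
      = (g 0 - binomialTransform g (n + 1)) / ((n : ℚ) + 1) := by
  rw [eq_div_iff (by positivity), binomialTransform, binomialTransform,
    Finset.sum_range_succ' _ (n + 1), Finset.sum_mul]
  simp only [pow_zero, Nat.choose_zero_right, Nat.cast_one, one_mul, sub_add_cancel_right,
    ← Finset.sum_neg_distrib]
  refine Finset.sum_congr rfl fun k _ => ?_
  have h : ((n : ℚ) + 1) * (n.choose k : ℚ) = ((n + 1).choose (k + 1) : ℚ) * ((k : ℚ) + 1) :=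
    mod_cast Nat.add_one_mul_choose_eq n k
  have hk : (k : ℚ) + 1 ≠ 0 := by positivity
  field_simp
  linear_combination (-1 : ℚ) ^ k * g (k + 1) * h

theorem binomialTransform_one_succ (n : ℕ) :
    binomialTransform (fun _ => 1) (n + 1) = 0 := by
  rw [binomialTransform_succ, sub_self]

theorem binomialTransform_inv_add_one (n : ℕ) :
    binomialTransform (fun k => ((k : ℚ) + 1)⁻¹) n = ((n : ℚ) + 1)⁻¹ := by
  simpa [binomialTransform_one_succ] using binomialTransform_shift_div (fun _ => 1) n

theorem binomialTransform_inv (n : ℕ) :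
    binomialTransform (fun k => (k : ℚ)⁻¹) n = -harmonic n := by
  induction n with
  | zero => simp [binomialTransform]
  | succ n ih =>
    rw [binomialTransform_succ, ih, harmonic_succ]
    push_cast
    rw [binomialTransform_inv_add_one]
    ring

theorem binomialTransform_harmonic_succ (n : ℕ) :
    binomialTransform harmonic (n + 1) = -((n : ℚ) + 1)⁻¹ := by
  rw [binomialTransform_succ, ← binomialTransform_inv_add_one]
  simp only [binomialTransform, ← Finset.sum_sub_distrib, ← Finset.sum_neg_distrib]
  refine Finset.sum_congr rfl fun k _ => ?_
  rw [harmonic_succ]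
  push_cast
  ring

theorem binomialTransform_harmonic_sq_succ (n : ℕ) :
    binomialTransform (fun k => harmonic k ^ 2) (n + 1)
      = harmonic (n + 1) / ((n : ℚ) + 1) - 2 / ((n : ℚ) + 1) ^ 2 := by
  have h : binomialTransform (fun k => harmonic k ^ 2) (n + 1)
      = binomialTransform (fun k => ((k + 1 : ℕ) : ℚ)⁻¹ / ((k : ℚ) + 1)) n
        - 2 * binomialTransform (fun k => harmonic (k + 1) / ((k : ℚ) + 1)) n := by
    rw [binomialTransform_succ]
    simp only [binomialTransform, ← Finset.sum_sub_distrib, Finset.mul_sum]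
    refine Finset.sum_congr rfl fun k _ => ?_
    rw [harmonic_succ]
    push_cast
    ring
  rw [h, binomialTransform_shift_div harmonic, binomialTransform_shift_div (fun k => (k : ℚ)⁻¹),
    binomialTransform_inv, binomialTransform_harmonic_succ, harmonic_zero, Nat.cast_zero, inv_zero]
  field_simp
  ring

theorem binomial_transform_harmonic_sq (n : ℕ) (hn : 1 ≤ n) :
    ∑ k ∈ Finset.range (n + 1),
        (-1 : ℚ) ^ k * (n.choose k : ℚ) * harmonic k ^ 2
      = harmonic n / (n : ℚ) - 2 / (n : ℚ) ^ 2 := by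
  obtain ⟨m, rfl⟩ := Nat.exists_eq_add_of_le' hn
  simpa [binomialTransform] using binomialTransform_harmonic_sq_succ m
end

section
/- Let n be an integer with n ≥ 1. Then ∑_{k=1}^{n} (-1)^{k-1} · C(n,k) · H_k / k = H^{(2)}_n, where all quotients are taken in ℚ (equivalently ℝ). -/
open Finset in
/-- Pascal's rule for alternating binomial sums. -/
theorem sum_range_alternating_choose_succ (f : ℕ → ℚ) (n : ℕ) :
    ∑ k ∈ range (n + 1), (-1 : ℚ) ^ k * ((n + 1).choose (k + 1) : ℚ) * f k
      = ∑ k ∈ range n, (-1 : ℚ) ^ k * (n.choose (k + 1) : ℚ) * f k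
        + ∑ k ∈ range (n + 1), (-1 : ℚ) ^ k * (n.choose k : ℚ) * f k := by
  have h : ∑ k ∈ range n, (-1 : ℚ) ^ k * (n.choose (k + 1) : ℚ) * f k
      = ∑ k ∈ range (n + 1), (-1 : ℚ) ^ k * (n.choose (k + 1) : ℚ) * f k := by
    simp [sum_range_succ]
  rw [h, ← sum_add_distrib]
  refine sum_congr rfl fun k _ => ?_
  rw [Nat.choose_succ_succ]
  push_cast
  ring

open Finset in
/-- Splitting off the first term of an alternating binomial sum. -/
theorem sum_range_alternating_choose_eq_sub (f : ℕ → ℚ) (n : ℕ) :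
    ∑ k ∈ range (n + 1), (-1 : ℚ) ^ k * (n.choose k : ℚ) * f k
      = f 0 - ∑ k ∈ range n, (-1 : ℚ) ^ k * (n.choose (k + 1) : ℚ) * f (k + 1) := by
  rw [sum_range_succ', sub_eq_neg_add, ← sum_neg_distrib]
  congr 1
  · exact sum_congr rfl fun k _ => by ring
  · simp

open Finset in
/-- Absorption identity for alternating binomial sums. -/
theorem sum_range_alternating_choose_div (f : ℕ → ℚ) (n : ℕ) :
    ∑ k ∈ range (n + 1), (-1 : ℚ) ^ k * (n.choose k : ℚ) * (f k / ((k : ℚ) + 1))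
      = (∑ k ∈ range (n + 1), (-1 : ℚ) ^ k * ((n + 1).choose (k + 1) : ℚ) * f k)
        / ((n : ℚ) + 1) := by
  rw [sum_div]
  refine sum_congr rfl fun k _ => ?_
  have h : ((n : ℚ) + 1) * n.choose k = (n + 1).choose (k + 1) * ((k : ℚ) + 1) := by
    exact_mod_cast Nat.add_one_mul_choose_eq n k
  have hn : (n : ℚ) + 1 ≠ 0 := by positivity
  have hk : (k : ℚ) + 1 ≠ 0 := by positivity
  field_simp
  linear_combination f k * h

open Finset in
theorem sum_range_alternating_choose_succ_one (n : ℕ) :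
    ∑ k ∈ range (n + 1), (-1 : ℚ) ^ k * ((n + 1).choose (k + 1) : ℚ) * 1 = 1 := by
  have h := sum_range_alternating_choose_succ (fun _ => 1) n
  rw [sum_range_alternating_choose_eq_sub (fun _ => 1) n] at h
  linarith

open Finset in
/-- The binomial transform of the harmonic numbers. -/
theorem sum_range_alternating_choose_harmonic (n : ℕ) :
    ∑ k ∈ range (n + 1), (-1 : ℚ) ^ k * ((n + 1).choose (k + 1) : ℚ) * harmonic (k + 1)
      = 1 / ((n : ℚ) + 1) := by
  have h := sum_range_alternating_choose_eq_sub harmonic n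
  have h' := sum_range_alternating_choose_div (fun _ => 1) n
  rw [sum_range_alternating_choose_succ_one] at h'
  have h'' : ∑ k ∈ range (n + 1), (-1 : ℚ) ^ k * (n.choose k : ℚ) * harmonic (k + 1)
      = ∑ k ∈ range (n + 1), (-1 : ℚ) ^ k * (n.choose k : ℚ) * harmonic k
        + ∑ k ∈ range (n + 1), (-1 : ℚ) ^ k * (n.choose k : ℚ) * (1 / ((k : ℚ) + 1)) := by
    rw [← sum_add_distrib]
    refine sum_congr rfl fun k _ => ?_
    rw [harmonic_succ]
    push_cast
    ring
  rw [sum_range_alternating_choose_succ (fun k => harmonic (k + 1)), h'', h, h', harmonic_zero]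
  ring

open Finset in
theorem sum_range_alternating_choose_harmonic_div (n : ℕ) :
    ∑ k ∈ range n, (-1 : ℚ) ^ k * (n.choose (k + 1) : ℚ) * (harmonic (k + 1) / ((k : ℚ) + 1))
      = harmonic2 n := by
  induction n with
  | zero => simp [harmonic2]
  | succ n ih =>
    rw [sum_range_alternating_choose_succ (fun k => harmonic (k + 1) / ((k : ℚ) + 1)), ih,
      sum_range_alternating_choose_div (fun k => harmonic (k + 1)),
      sum_range_alternating_choose_harmonic, harmonic2, harmonic2, sum_range_succ, div_div, sq]

theorem harmonic_over_k_transform (n : ℕ) (hn : 1 ≤ n) :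
    ∑ k ∈ Finset.Icc 1 n,
        (-1 : ℚ) ^ (k + 1) * (n.choose k : ℚ) * harmonic k / (k : ℚ)
      = harmonic2 n := by
  rw [← sum_range_alternating_choose_harmonic_div, Finset.range_eq_Ico,
    ← Finset.Ico_add_one_right_eq_Icc, ← Finset.sum_Ico_add' _ 0 n 1]
  refine Finset.sum_congr rfl fun k _ => ?_
  push_cast
  ring
end

section
/- Let n be an integer with n ≥ 0. Then ∑_{k=0}^{n} (-1)^k · C(n,k) / (2k+1)^2 = (2^{2n+1}/(n+1)) · O_{n+1} / C(2(n+1), n+1), where all quotients are taken in ℚ (equivalently ℝ). -/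
/-- The odd harmonic number `O m = ∑_{j=1}^m 1/(2j-1)`. -/
def oddHarmonic (m : ℕ) : ℚ := ∑ j ∈ Finset.range m, (1 : ℚ) / (2 * (j : ℚ) + 1)

/-- The alternating binomial sum `∑_{k=0}^n (-1)^k C(n,k) / (2k+1)^p`. -/
def alternatingOddSum (p n : ℕ) : ℚ :=
  ∑ k ∈ Finset.range (n + 1), (-1 : ℚ) ^ k * (n.choose k : ℚ) / (2 * (k : ℚ) + 1) ^ p

theorem alternatingOddSum_zero_right (p : ℕ) : alternatingOddSum p 0 = 1 := by
  simp [alternatingOddSum]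

theorem alternatingOddSum_zero_succ (n : ℕ) : alternatingOddSum 0 (n + 1) = 0 := by
  have h := add_pow (-1 : ℚ) 1 (n + 1)
  simp only [one_pow, mul_one, neg_add_cancel, ne_eq, Nat.succ_ne_zero, not_false_eq_true,
    zero_pow] at h
  simpa [alternatingOddSum] using h.symm

theorem alternatingOddSum_succ_succ (p n : ℕ) :
    (2 * (n : ℚ) + 3) * alternatingOddSum (p + 1) (n + 1) =
      2 * ((n : ℚ) + 1) * alternatingOddSum (p + 1) n + alternatingOddSum p (n + 1) := by
  have hext : alternatingOddSum (p + 1) n = ∑ k ∈ Finset.range (n + 1 + 1),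
      (-1 : ℚ) ^ k * (n.choose k : ℚ) / (2 * (k : ℚ) + 1) ^ (p + 1) := by
    rw [Finset.sum_range_succ]
    simp [alternatingOddSum]
  rw [hext]
  simp only [alternatingOddSum, Finset.mul_sum, ← Finset.sum_add_distrib]
  refine Finset.sum_congr rfl fun k hk => ?_
  have hkn : k ≤ n + 1 := by simpa [Nat.lt_succ_iff] using hk
  have hchoose : (n.choose k : ℚ) * ((n : ℚ) + 1) =
      ((n + 1).choose k : ℚ) * ((n : ℚ) + 1 - k) := by
    have h := Nat.choose_mul_succ_eq n k
    rw [← Nat.cast_inj (R := ℚ)] at h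
    push_cast [Nat.cast_sub hkn] at h
    exact h
  have hpos : (2 * (k : ℚ) + 1) ≠ 0 := by positivity
  rw [pow_succ (2 * (k : ℚ) + 1) p]
  field_simp
  linear_combination (-2 : ℚ) * hchoose

theorem alternatingOddSum_one (n : ℕ) :
    alternatingOddSum 1 n =
      (2 : ℚ) ^ (2 * n + 1) / (((n : ℚ) + 1) * ((n + 1).centralBinom : ℚ)) := by
  induction n with
  | zero => norm_num [alternatingOddSum_zero_right, Nat.centralBinom, Nat.choose]
  | succ n ih =>
    have hrec := alternatingOddSum_succ_succ 0 n
    rw [zero_add, alternatingOddSum_zero_succ, ih] at hrec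
    have hcb : ((n : ℚ) + 1 + 1) * ((n + 1 + 1).centralBinom : ℚ) =
        2 * (2 * (n + 1) + 1) * ((n + 1).centralBinom : ℚ) := by
      exact_mod_cast Nat.succ_mul_centralBinom_succ (n + 1)
    have hne : ((n + 1).centralBinom : ℚ) ≠ 0 := by
      exact_mod_cast Nat.centralBinom_ne_zero (n + 1)
    have hn : (2 * (n : ℚ) + 3) ≠ 0 := by positivity
    refine mul_left_cancel₀ hn (hrec.trans ?_)
    push_cast
    rw [hcb]
    have hn' : (2 * ((n : ℚ) + 1) + 1) ≠ 0 := by positivity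
    field_simp
    ring

theorem alternatingOddSum_two (n : ℕ) :
    alternatingOddSum 2 n = alternatingOddSum 1 n * oddHarmonic (n + 1) := by
  induction n with
  | zero => simp [alternatingOddSum_zero_right, oddHarmonic]
  | succ n ih =>
    have hone := alternatingOddSum_succ_succ 0 n
    have htwo := alternatingOddSum_succ_succ 1 n
    rw [zero_add, alternatingOddSum_zero_succ] at hone
    rw [one_add_one_eq_two, ih] at htwo
    have hn : (2 * (n : ℚ) + 3) ≠ 0 := by positivity
    have hodd : (2 * (n : ℚ) + 3) * oddHarmonic (n + 1 + 1) =
        (2 * (n : ℚ) + 3) * oddHarmonic (n + 1) + 1 := by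
      have hn' : (2 * ((n : ℚ) + 1) + 1) ≠ 0 := by positivity
      rw [oddHarmonic, Finset.sum_range_succ, ← oddHarmonic]
      push_cast
      field_simp
      ring
    refine mul_left_cancel₀ hn ?_
    linear_combination htwo - oddHarmonic (n + 1) * hone - alternatingOddSum 1 (n + 1) * hodd

theorem alternating_sum_odd_sq (n : ℕ) :
    ∑ k ∈ Finset.range (n + 1),
        (-1 : ℚ) ^ k * (n.choose k : ℚ) / (2 * (k : ℚ) + 1) ^ 2
      = (2 : ℚ) ^ (2 * n + 1) / ((n : ℚ) + 1) *
          (oddHarmonic (n + 1) / ((2 * (n + 1)).choose (n + 1) : ℚ)) := by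
  have h := alternatingOddSum_two n
  rw [alternatingOddSum_one, Nat.centralBinom] at h
  rw [← alternatingOddSum, h, div_mul_div_comm, div_mul_eq_mul_div]
end

section
/- Let n be an integer with n ≥ 1. Then ∑_{k=1}^{n} (-1)^{k+1} · C(n,k) · O_k = 2^{2n−1} / (n · C(2n, n)), where all quotients are taken in ℚ (equivalently ℝ). -/
theorem oddHarmonic_succ (m : ℕ) :
    oddHarmonic (m + 1) = oddHarmonic m + 1 / (2 * (m : ℚ) + 1) :=
  Finset.sum_range_succ _ _

theorem fwdDiff_oddHarmonic :
    fwdDiff 1 oddHarmonic = fun m : ℕ => (1 : ℚ) / (2 * (m : ℚ) + 1) := by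
  ext m
  simp [fwdDiff, oddHarmonic_succ]

theorem fwdDiff_iter_one_div_odd (m x : ℕ) :
    (fwdDiff 1)^[m] (fun y : ℕ => (1 : ℚ) / (2 * (y : ℚ) + 1)) x =
      (-2) ^ m * m.factorial / ∏ i ∈ Finset.range (m + 1), (2 * ((x : ℚ) + i) + 1) := by
  induction m generalizing x with
  | zero => simp
  | succ m ih =>
    rw [Function.iterate_succ_apply', fwdDiff, ih, ih]
    have shift : ∀ i : ℕ, 2 * (((x + 1 : ℕ) : ℚ) + i) + 1 = 2 * ((x : ℚ) + (i + 1 : ℕ)) + 1 := by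
      intro i
      push_cast
      ring
    simp only [shift]
    rw [Finset.prod_range_succ (fun i : ℕ => 2 * ((x : ℚ) + (i + 1 : ℕ)) + 1) m,
      Finset.prod_range_succ' _ (m + 1), Finset.prod_range_succ' _ m,
      Finset.prod_range_succ (fun i : ℕ => 2 * ((x : ℚ) + (i + 1 : ℕ)) + 1) m,
      Nat.factorial_succ]
    have hprod : ∏ i ∈ Finset.range m, (2 * ((x : ℚ) + (i + 1 : ℕ)) + 1) ≠ 0 :=
      Finset.prod_ne_zero_iff.mpr fun i _ => by positivity
    have hlast : 2 * ((x : ℚ) + (m + 1 : ℕ)) + 1 ≠ 0 := by positivity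
    have hfirst : 2 * ((x : ℚ) + (0 : ℕ)) + 1 ≠ 0 := by positivity
    field_simp
    push_cast
    ring

theorem two_pow_mul_factorial_div_prod_odd (m : ℕ) :
    (2 : ℚ) ^ m * m.factorial / ∏ i ∈ Finset.range (m + 1), (2 * (i : ℚ) + 1) =
      2 ^ (2 * m + 1) / (((m + 1 : ℕ) : ℚ) * (m + 1).centralBinom) := by
  induction m with
  | zero => norm_num [Nat.centralBinom, Nat.choose]
  | succ m ih =>
    have hrec : ((m + 2 : ℕ) : ℚ) * (m + 2).centralBinom =
        2 * (2 * (m + 1 : ℕ) + 1) * (m + 1).centralBinom := by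
      exact_mod_cast Nat.succ_mul_centralBinom_succ (m + 1)
    have hcb : ((m + 1).centralBinom : ℚ) ≠ 0 := by
      exact_mod_cast Nat.centralBinom_ne_zero (m + 1)
    have hodd : 2 * ((m + 1 : ℕ) : ℚ) + 1 ≠ 0 := by positivity
    have hm : ((m + 1 : ℕ) : ℚ) ≠ 0 := by positivity
    rw [hrec, Finset.prod_range_succ, Nat.factorial_succ]
    calc
      _ = (2 : ℚ) ^ m * m.factorial / (∏ i ∈ Finset.range (m + 1), (2 * (i : ℚ) + 1)) *
          (2 * (m + 1 : ℕ) / (2 * (m + 1 : ℕ) + 1)) := by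
        rw [div_mul_div_comm]
        push_cast
        ring
      _ = _ := by
        rw [ih]
        field_simp
        ring

theorem oddHarmonic_transform (n : ℕ) (hn : 1 ≤ n) :
    ∑ k ∈ Finset.Icc 1 n,
        (-1 : ℚ) ^ (k + 1) * (n.choose k : ℚ) * oddHarmonic k
      = (2 : ℚ) ^ (2 * n - 1) / ((n : ℚ) * ((2 * n).choose n : ℚ)) := by
  obtain ⟨m, rfl⟩ : ∃ m, n = m + 1 := ⟨n - 1, by omega⟩
  have hdiff := fwdDiff_iter_eq_sum_shift 1 oddHarmonic (m + 1) 0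
  rw [Function.iterate_succ_apply, fwdDiff_oddHarmonic, fwdDiff_iter_one_div_odd] at hdiff
  have hsum : ∑ k ∈ Finset.Icc 1 (m + 1),
        (-1 : ℚ) ^ (k + 1) * ((m + 1).choose k : ℚ) * oddHarmonic k =
      (-1) ^ m * ∑ k ∈ Finset.range (m + 1 + 1),
        ((-1 : ℤ) ^ (m + 1 - k) * ((m + 1).choose k : ℤ)) • oddHarmonic (0 + k • 1) := by
    rw [Finset.range_eq_Ico, Finset.sum_eq_sum_Ico_succ_bot (by omega)]
    simp only [zero_add, smul_eq_mul, mul_one]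
    have h0 : oddHarmonic 0 = 0 := by simp [oddHarmonic]
    rw [h0, smul_zero, zero_add, Finset.mul_sum]
    refine Finset.sum_congr rfl fun k hk => ?_
    have hsign : (-1 : ℚ) ^ (k + 1) = (-1) ^ m * (-1) ^ (m + 1 - k) := by
      rw [Finset.mem_Ico] at hk
      rw [← pow_add]
      exact neg_one_pow_congr (by grind)
    rw [hsign, zsmul_eq_mul]
    push_cast
    ring
  rw [hsum, ← hdiff, show 2 * (m + 1) - 1 = 2 * m + 1 by omega,
    ← Nat.centralBinom_eq_two_mul_choose, ← two_pow_mul_factorial_div_prod_odd,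
    ← mul_div_assoc, ← mul_assoc, ← mul_pow]
  norm_num
end
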